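/- Let d ≥ 2 and d + 1 ≤ m ≤ n be integers, and let J ⊆ E be the two-sided ideal generated by {∂e_F : F ⊆ {1,…,m}, |F| = d + 1} (the Orlik–Solomon ideal of an arrangement whose matroid is U_{d,m} plus n − m coloops; such a J has a d-linear resolution). Then R^p(E/J) = {0} for 1 ≤ p ≤ d − 2, and R^{d−1}(E/J) = span_K{e_i − e_1 : 2 ≤ i ≤ m}; in particular R^{d−1}(E/J) is irreducible. -/

import Mathlib

open scoped BigOperators

noncomputable section

/-- The exterior algebra `E = Λ(K^n)`. -/
abbrev ExtE (K : Type*) [Field K] (n : ℕ) := ExteriorAlgebra K (Fin n → K)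

/-- The generator `e_i` of the exterior algebra. -/
noncomputable def eVar (K : Type*) [Field K] (n : ℕ) (i : Fin n) : ExtE K n :=
  ExteriorAlgebra.ι K (Pi.single i 1)

/-- The monomial `e_F = e_{i_1} ∧ ⋯ ∧ e_{i_p}` for `F = {i_1 < ⋯ < i_p}`. -/
noncomputable def eMonF (K : Type*) [Field K] (n : ℕ) (F : Finset (Fin n)) : ExtE K n :=
  ((F.sort (· ≤ ·)).map (eVar K n)).prod

/-- The `p`-th graded component `E_p` of the exterior algebra. -/
noncomputable def eGrade (K : Type*) [Field K] (n : ℕ) (p : ℕ) : Submodule K (ExtE K n) :=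
  (LinearMap.range (ExteriorAlgebra.ι K : (Fin n → K) →ₗ[K] ExtE K n)) ^ p

/-- The two-sided ideal of `E` generated by a set `S`, as a `K`-submodule of `E`. -/
noncomputable def tsIdeal (K : Type*) [Field K] (n : ℕ) (S : Set (ExtE K n)) :
    Submodule K (ExtE K n) :=
  Submodule.span K {x : ExtE K n | ∃ a s b : ExtE K n, s ∈ S ∧ x = a * s * b}

/-- `∂e_F = ∑_{j=1}^t (−1)^{j−1} e_{F∖{i_j}}` for `F = {i_1 < ⋯ < i_t}`. -/
noncomputable def osDelta (K : Type*) [Field K] (n : ℕ) (F : Finset (Fin n)) : ExtE K n :=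
  ∑ k ∈ F, ((-1 : K) ^ (F.filter (fun j => j < k)).card) • eMonF K n (F.erase k)

/-- The first resonance variety `R^1(E/J)` of `E/J`, viewed inside `E_1`. -/
noncomputable def resonance1 (K : Type*) [Field K] (n : ℕ) (J : Submodule K (ExtE K n)) :
    Set (ExtE K n) :=
  {u | u ∈ eGrade K n 1 ∧ (u = 0 ∨ ∃ v ∈ eGrade K n 1, u * v ∈ J ∧ u * v ≠ 0)}

/-- The `q`-th resonance variety `R^q(E/J)` of `E/J` for `q ≥ 1`, viewed inside `E_1`. -/
noncomputable def resonanceQ (K : Type*) [Field K] (n : ℕ) (J : Submodule K (ExtE K n))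
    (q : ℕ) : Set (ExtE K n) :=
  {u | u ∈ eGrade K n 1 ∧ (u = 0 ∨ ∃ v ∈ eGrade K n q, v ∉ J ∧
    (¬ ∃ w ∈ eGrade K n (q - 1), v = u * w) ∧ u * v ∈ J ∧ u * v ≠ 0)}

/-- The rank variety `V_E(E/J)`, viewed inside `E_1`. -/
noncomputable def rankVar (K : Type*) [Field K] (n : ℕ) (J : Submodule K (ExtE K n)) :
    Set (ExtE K n) :=
  {u | u ∈ eGrade K n 1 ∧ ∃ w : ExtE K n, u * w ∈ J ∧
    ¬ ∃ j ∈ J, ∃ x : ExtE K n, w = j + u * x}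

section helpers
variable {K : Type*} [Field K] {n : ℕ}

/-- Contraction by a linear form. -/
def ct (φ : Module.Dual K (Fin n → K)) : ExtE K n →ₗ[K] ExtE K n :=
  CliffordAlgebra.contractLeft (Q := (0 : QuadraticForm K (Fin n → K))) φ

lemma ct_mul (φ : Module.Dual K (Fin n → K)) (a : Fin n → K) (b : ExtE K n) :
    ct φ (ExteriorAlgebra.ι K a * b) = φ a • b - ExteriorAlgebra.ι K a * ct φ b :=
  CliffordAlgebra.contractLeft_ι_mul (Q := (0 : QuadraticForm K (Fin n → K))) (d := φ) a b

lemma ct_one (φ : Module.Dual K (Fin n → K)) : ct φ (1 : ExtE K n) = 0 :=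
  CliffordAlgebra.contractLeft_one (Q := (0 : QuadraticForm K (Fin n → K))) (d := φ)

lemma ct_ct (φ : Module.Dual K (Fin n → K)) (x : ExtE K n) : ct φ (ct φ x) = 0 :=
  CliffordAlgebra.contractLeft_contractLeft (Q := (0 : QuadraticForm K (Fin n → K))) (d := φ) x

lemma ct_comm (φ ψ : Module.Dual K (Fin n → K)) (x : ExtE K n) :
    ct φ (ct ψ x) = - ct ψ (ct φ x) :=
  CliffordAlgebra.contractLeft_comm (Q := (0 : QuadraticForm K (Fin n → K))) (d := φ) (d' := ψ) x

lemma swap_mul (a b : Fin n → K) (x : ExtE K n) :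
    ExteriorAlgebra.ι K a * (ExteriorAlgebra.ι K b * x) =
      - (ExteriorAlgebra.ι K b * (ExteriorAlgebra.ι K a * x)) := by
  have h := ExteriorAlgebra.ι_add_mul_swap (R := K) a b
  rw [← mul_assoc, ← mul_assoc, ← neg_mul, eq_neg_of_add_eq_zero_left h]

lemma sq_mul (a : Fin n → K) (x : ExtE K n) :
    ExteriorAlgebra.ι K a * (ExteriorAlgebra.ι K a * x) = 0 := by
  rw [← mul_assoc, ExteriorAlgebra.ι_sq_zero, zero_mul]

lemma eMonF_insert (a : Fin n) (F : Finset (Fin n)) (h : ∀ x ∈ F, a < x) :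
    eMonF K n (insert a F) = eVar K n a * eMonF K n F := by
  unfold eMonF
  rw [Finset.sort_insert (r := (· ≤ ·)) (fun b hb => (h b hb).le) (fun ha => lt_irrefl _ (h a ha))]
  simp

lemma eMonF_empty : eMonF K n ∅ = 1 := by simp [eMonF]

lemma osDelta_insert (a : Fin n) (F : Finset (Fin n)) (h : ∀ x ∈ F, a < x) :
    osDelta K n (insert a F) = eMonF K n F - eVar K n a * osDelta K n F := by
  have ha : a ∉ F := fun ha => lt_irrefl _ (h a ha)
  unfold osDelta
  rw [Finset.sum_insert ha, Finset.erase_insert ha]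
  have h0 : (insert a F).filter (fun j => j < a) = ∅ := by
    ext j
    simp only [Finset.mem_filter, Finset.mem_insert, Finset.notMem_empty, iff_false]
    rintro ⟨rfl | hj, hlt⟩
    · exact lt_irrefl _ hlt
    · exact lt_asymm hlt (h j hj)
  rw [h0, Finset.card_empty, pow_zero, one_smul, sub_eq_add_neg, Finset.mul_sum,
    ← Finset.sum_neg_distrib]
  congr 1
  refine Finset.sum_congr rfl fun k hk => ?_
  have hak : a ≠ k := (h k hk).ne
  rw [Finset.erase_insert_of_ne hak, eMonF_insert a _ (fun x hx => h x (Finset.mem_of_mem_erase hx)),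
    Finset.filter_insert, if_pos (h k hk), Finset.card_insert_of_notMem (by simp [ha]), pow_succ]
  simp

lemma ct_eMonF (φ : Module.Dual K (Fin n → K)) (c : K) (F : Finset (Fin n))
    (h : ∀ i ∈ F, φ (Pi.single i 1) = c) : ct φ (eMonF K n F) = c • osDelta K n F := by
  induction F using Finset.induction_on_min with
  | empty => simp [eMonF_empty, ct_one, osDelta]
  | insert a F ha ih =>
    rw [eMonF_insert a F ha, osDelta_insert a F ha, eVar, ct_mul, h a (by simp),
      ih (fun i hi => h i (by simp [hi])), smul_sub, mul_smul_comm]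

/-- Sum of the coordinates. -/
def dsum : Module.Dual K (Fin n → K) := ∑ i, LinearMap.proj i

lemma dsum_single (i : Fin n) : (dsum : Module.Dual K (Fin n → K)) (Pi.single i 1) = 1 := by
  simp [dsum, LinearMap.sum_apply, Pi.single_apply]

lemma osDelta_eq (F : Finset (Fin n)) : osDelta K n F = ct dsum (eMonF K n F) := by
  rw [ct_eMonF dsum 1 F (fun i _ => dsum_single i), one_smul]

lemma ct_osDelta (φ : Module.Dual K (Fin n → K)) (c : K) (F : Finset (Fin n))
    (h : ∀ i ∈ F, φ (Pi.single i 1) = c) : ct φ (osDelta K n F) = 0 := by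
  rw [osDelta_eq, ct_comm, ct_eMonF φ c F h, map_smul, osDelta_eq, ct_ct]; simp

lemma eVar_mul_eMonF (i : Fin n) (F : Finset (Fin n)) :
    (i ∈ F → eVar K n i * eMonF K n F = 0) ∧
      ∃ c : K, eVar K n i * eMonF K n F = c • eMonF K n (insert i F) := by
  induction F using Finset.induction_on_min with
  | empty => exact ⟨by simp, 1, by rw [eMonF_insert i ∅ (by simp), one_smul]⟩
  | insert a F ha ih =>
    obtain ⟨ih1, c, hc⟩ := ih
    rcases lt_trichotomy i a with h | h | h
    · have h' : ∀ x ∈ insert a F, i < x := by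
        intro x hx
        rcases Finset.mem_insert.1 hx with rfl | hx
        · exact h
        · exact h.trans (ha x hx)
      exact ⟨fun hi => absurd (h' i hi) (lt_irrefl _), 1, by rw [eMonF_insert i _ h', one_smul]⟩
    · subst h
      have : eVar K n i * eMonF K n (insert i F) = 0 := by
        rw [eMonF_insert i F ha]; exact sq_mul _ _
      exact ⟨fun _ => this, 0, by rw [this, zero_smul]⟩
    · have e : eVar K n i * eMonF K n (insert a F) =
          - (eVar K n a * (eVar K n i * eMonF K n F)) := by
        rw [eMonF_insert a F ha]; exact swap_mul _ _ _
      refine ⟨fun hi => ?_, -c, ?_⟩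
      · have : i ∈ F := by
          rcases Finset.mem_insert.1 hi with rfl | hx
          · exact absurd h (lt_irrefl _)
          · exact hx
        rw [e, ih1 this]; simp
      · rw [e, hc, Finset.insert_comm, eMonF_insert a (insert i F)]
        · simp
        · intro x hx
          rcases Finset.mem_insert.1 hx with rfl | hx
          · exact h
          · exact ha x hx

lemma pow_le_span (m k : ℕ) :
    (Submodule.span K {x : ExtE K n | ∃ i : Fin n, (i : ℕ) < m ∧ x = eVar K n i}) ^ k ≤
      Submodule.span K {x : ExtE K n | ∃ F : Finset (Fin n), (∀ i ∈ F, (i : ℕ) < m) ∧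
        F.card = k ∧ x = eMonF K n F} := by
  induction k with
  | zero =>
    rw [pow_zero, Submodule.one_eq_span]
    refine Submodule.span_mono ?_
    rintro x rfl
    exact ⟨∅, by simp, by simp, by rw [eMonF_empty]⟩
  | succ k ih =>
    rw [pow_succ']
    refine (mul_le_mul' le_rfl ih).trans ?_
    rw [Submodule.span_mul_span, Submodule.span_le]
    rintro x ⟨_, ⟨i, hi, rfl⟩, _, ⟨F, hF, hc, rfl⟩, rfl⟩
    obtain ⟨h1, c, h2⟩ := eVar_mul_eMonF (K := K) i F
    by_cases hiF : i ∈ F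
    · change eVar K n i * eMonF K n F ∈ _
      rw [h1 hiF]; exact Submodule.zero_mem _
    · change eVar K n i * eMonF K n F ∈ _
      rw [h2]
      refine Submodule.smul_mem _ _ (Submodule.subset_span ⟨insert i F, ?_, ?_, rfl⟩)
      · intro j hj
        rcases Finset.mem_insert.1 hj with rfl | hj
        · exact hi
        · exact hF j hj
      · rw [Finset.card_insert_of_notMem hiF, hc]

lemma eMonF_mem (F : Finset (Fin n)) : eMonF K n F ∈ eGrade K n F.card := by
  induction F using Finset.induction_on_min with
  | empty => rw [eMonF_empty, Finset.card_empty, eGrade, pow_zero]; exact Submodule.one_le.1 le_rfl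
  | insert a F ha ih =>
    rw [eMonF_insert a F ha, Finset.card_insert_of_notMem (fun h => lt_irrefl _ (ha a h)), eGrade,
      pow_succ']
    exact Submodule.mul_mem_mul ⟨_, rfl⟩ ih

lemma osDelta_mem (F : Finset (Fin n)) (d : ℕ) (h : F.card = d + 1) :
    osDelta K n F ∈ eGrade K n d := by
  refine Submodule.sum_mem _ fun k hk => Submodule.smul_mem _ _ ?_
  have := eMonF_mem (K := K) (F.erase k)
  rwa [Finset.card_erase_of_mem hk, h] at this

instance eGradeGA : GradedAlgebra (eGrade K n) :=
  inferInstanceAs (GradedAlgebra (fun i : ℕ ↦ ⋀[K]^i (Fin n → K)))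

lemma grade_zero (b : ExtE K n) (hb : b ∈ eGrade K n 0) : ∃ c : K, b = algebraMap K _ c := by
  rw [eGrade, pow_zero, Submodule.mem_one] at hb
  obtain ⟨c, rfl⟩ := hb
  exact ⟨c, rfl⟩

lemma J_proj (m d : ℕ) (x : ExtE K n)
    (hx : x ∈ tsIdeal K n {x : ExtE K n | ∃ F : Finset (Fin n),
      (∀ i ∈ F, (i : ℕ) < m) ∧ F.card = d + 1 ∧ x = osDelta K n F}) :
    (∀ k < d, GradedAlgebra.proj (eGrade K n) k x = 0) ∧
    ∀ (φ : Module.Dual K (Fin n → K)) (c : K),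
      (∀ i : Fin n, (i : ℕ) < m → φ (Pi.single i 1) = c) →
        ct φ (GradedAlgebra.proj (eGrade K n) d x) = 0 := by
  induction hx using Submodule.span_induction with
  | zero => simp
  | add x y _ _ hx hy =>
    refine ⟨fun k hk => by rw [map_add, hx.1 k hk, hy.1 k hk, add_zero], fun φ c h => ?_⟩
    rw [map_add, map_add, hx.2 φ c h, hy.2 φ c h, add_zero]
  | smul a x _ hx =>
    refine ⟨fun k hk => by rw [map_smul, hx.1 k hk, smul_zero], fun φ c h => ?_⟩
    rw [map_smul, map_smul, hx.2 φ c h, smul_zero]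
  | mem x hx =>
    obtain ⟨a, s, b, ⟨F, hF, hc, rfl⟩, rfl⟩ := hx
    have hs := osDelta_mem (K := K) F d hc
    induction a using DirectSum.Decomposition.inductionOn (eGrade K n) with
    | zero => simp
    | add x y hx hy =>
      refine ⟨fun k hk => by rw [add_mul, add_mul, map_add, hx.1 k hk, hy.1 k hk, add_zero],
        fun φ c h => ?_⟩
      rw [add_mul, add_mul, map_add, map_add, hx.2 φ c h, hy.2 φ c h, add_zero]
    | @homogeneous i a =>
      have has : (a : ExtE K n) * osDelta K n F ∈ eGrade K n (i + d) :=
        SetLike.mul_mem_graded a.2 hs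
      refine ⟨fun k hk => ?_, fun φ c h => ?_⟩
      · rw [GradedAlgebra.proj_apply]
        exact DirectSum.coe_decompose_mul_of_left_mem_of_not_le _ has (by omega)
      · rw [GradedAlgebra.proj_apply]
        by_cases hi : i = 0
        · subst hi
          rw [DirectSum.coe_decompose_mul_of_left_mem_of_le _ has (by omega)]
          have e : d - (0 + d) = 0 := by omega
          rw [e]
          obtain ⟨c1, h1⟩ := grade_zero _ a.2
          obtain ⟨c2, h2⟩ := grade_zero _ (DirectSum.decompose (eGrade K n) b 0).2
          rw [h1, h2, ← Algebra.smul_def, ← Algebra.commutes, ← Algebra.smul_def, map_smul,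
            map_smul, ct_osDelta φ c F (fun i hi => h i (hF i hi)), smul_zero, smul_zero]
        · rw [DirectSum.coe_decompose_mul_of_left_mem_of_not_le _ has (by omega), map_zero]

lemma proj_self (k : ℕ) (x : ExtE K n) (hx : x ∈ eGrade K n k) :
    GradedAlgebra.proj (eGrade K n) k x = x := by
  rw [GradedAlgebra.proj_apply]
  exact DirectSum.decompose_of_mem_same _ hx

/-- The space of differences. -/
def Wsp (K : Type*) [Field K] (n m : ℕ) (z : Fin n) : Submodule K (Fin n → K) :=
  Submodule.span K {x | ∃ i : Fin n, 0 < (i : ℕ) ∧ (i : ℕ) < m ∧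
    x = Pi.single i 1 - Pi.single z 1}

lemma map_Wsp (m : ℕ) (z : Fin n) : (Wsp K n m z).map (ExteriorAlgebra.ι K) =
    Submodule.span K {x : ExtE K n | ∃ i : Fin n, 0 < (i : ℕ) ∧ (i : ℕ) < m ∧
        x = eVar K n i - eVar K n z} := by
  rw [Wsp, Submodule.map_span]
  congr 1
  ext x
  constructor
  · rintro ⟨_, ⟨i, h1, h2, rfl⟩, rfl⟩
    exact ⟨i, h1, h2, by rw [map_sub]; rfl⟩
  · rintro ⟨i, h1, h2, rfl⟩
    exact ⟨_, ⟨i, h1, h2, rfl⟩, by rw [map_sub]; rfl⟩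

lemma dsum_Wsp (m : ℕ) (z : Fin n) : Wsp K n m z ≤ LinearMap.ker dsum := by
  rw [Wsp, Submodule.span_le]
  rintro _ ⟨i, -, -, rfl⟩
  simp [dsum_single]

lemma finrank_Wsp (m d : ℕ) (hdm : d + 1 ≤ m) (hmn : m ≤ n) (z : Fin n) (hz : (z : ℕ) = 0) :
    d ≤ Module.finrank K (Wsp K n m z) := by
  let f : Fin d → (Fin n → K) := fun j =>
    Pi.single (⟨j + 1, by omega⟩ : Fin n) 1 - Pi.single z 1
  have hf : LinearIndependent K f := by
    rw [Fintype.linearIndependent_iff]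
    intro g hg i
    have := congrFun hg (⟨i + 1, by omega⟩ : Fin n)
    have hzi : (⟨i + 1, by omega⟩ : Fin n) ≠ z := by
      intro h; rw [← h] at hz; simp at hz
    rw [Finset.sum_apply, Finset.sum_eq_single i] at this
    · simpa [f, Pi.single_apply, hzi] using this
    · intro j _ hj
      have hji : (⟨i + 1, by omega⟩ : Fin n) ≠ ⟨j + 1, by omega⟩ := by
        intro h
        rw [Fin.mk.injEq] at h
        exact hj (Fin.ext (by omega))
      simp only [f, Pi.smul_apply, Pi.sub_apply, Pi.single_apply, if_neg hzi, if_neg hji]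
      simp
    · simp
  have h1 := finrank_span_eq_card hf
  rw [Fintype.card_fin] at h1
  rw [← h1]
  refine Submodule.finrank_mono (Submodule.span_mono ?_)
  rintro _ ⟨j, rfl⟩
  exact ⟨⟨j + 1, by omega⟩, by simp, by simp; omega, rfl⟩

lemma exists_v (W : Submodule K (Fin n → K)) (d : ℕ) (hW : d ≤ Module.finrank K W)
    (a : Fin n → K) (ha : a ≠ 0) (k : ℕ) (hk : k + 1 ≤ d) :
    ∃ (v : ExtE K n) (U : Submodule K (Fin n → K)), v ∈ (W.map (ExteriorAlgebra.ι K)) ^ k ∧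
      a ∈ U ∧ Module.finrank K U ≤ k + 1 ∧
      (∀ φ : Module.Dual K (Fin n → K), U ≤ LinearMap.ker φ → ct φ v = 0) ∧
      (∀ φ : Module.Dual K (Fin n → K), W ≤ LinearMap.ker φ → ct φ v = 0) ∧
      ExteriorAlgebra.ι K a * v ≠ 0 := by
  induction k with
  | zero =>
    refine ⟨1, Submodule.span K {a}, by rw [pow_zero]; exact Submodule.one_le.1 le_rfl,
      Submodule.mem_span_singleton_self a, finrank_span_singleton ha |>.le,
      fun φ _ => ct_one φ, fun φ _ => ct_one φ, ?_⟩
    rw [mul_one]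
    intro h
    exact ha (ExteriorAlgebra.ι_eq_zero_iff a |>.1 h)
  | succ k ih =>
    obtain ⟨v, U, hv, haU, hU, h1, h2, h3⟩ := ih (by omega)
    obtain ⟨w, hwW, hwU⟩ : ∃ w ∈ W, w ∉ U := by
      by_contra! hc
      have := Submodule.finrank_mono (R := K) (s := W) (t := U) hc
      omega
    refine ⟨ExteriorAlgebra.ι K w * v, U ⊔ Submodule.span K {w}, ?_, Submodule.mem_sup_left haU,
      ?_, ?_, ?_, ?_⟩
    · rw [pow_succ']
      exact Submodule.mul_mem_mul (Submodule.mem_map_of_mem hwW) hv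
    · have := Submodule.finrank_add_le_finrank_add_finrank U (Submodule.span K {w})
      have h4 := finrank_span_le_card (R := K) ({w} : Set (Fin n → K))
      simp at h4
      omega
    · intro φ hφ
      have hw : φ w = 0 := hφ (Submodule.mem_sup_right (Submodule.mem_span_singleton_self w))
      rw [ct_mul, hw, h1 φ (le_sup_left.trans hφ)]; simp
    · intro φ hφ
      have hw : φ w = 0 := hφ hwW
      rw [ct_mul, hw, h2 φ hφ]; simp
    · obtain ⟨φ, hφw, hφ⟩ := Submodule.exists_le_ker_of_notMem hwU
      intro h0
      have e := congrArg (ct φ) h0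
      have hφa : φ a = 0 := hφ haU
      rw [ct_mul, ct_mul, h1 φ hφ, hφa] at e
      simp [hφw] at e
      exact h3 e

end helpers

/-- For `d ≥ 2`, `d + 1 ≤ m ≤ n` and `J` the Orlik–Solomon ideal of the
uniform matroid `U_{d,m}` plus `n − m` coloops, one has `R^p(E/J) = {0}` for
`1 ≤ p ≤ d − 2`, and `R^{d−1}(E/J) = span_K{e_i − e_1 : 2 ≤ i ≤ m}`. -/
theorem stmt4 {K : Type*} [Field K] [CharZero K] {n m d : ℕ}
    (hd : 2 ≤ d) (hdm : d + 1 ≤ m) (hmn : m ≤ n)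
    (J : Submodule K (ExtE K n))
    (hJ : J = tsIdeal K n {x : ExtE K n | ∃ F : Finset (Fin n),
      (∀ i ∈ F, (i : ℕ) < m) ∧ F.card = d + 1 ∧ x = osDelta K n F}) :
    (∀ p : ℕ, 1 ≤ p → p ≤ d - 2 → resonanceQ K n J p = {0}) ∧
    resonanceQ K n J (d - 1) =
      (Submodule.span K {x : ExtE K n | ∃ i : Fin n, 0 < (i : ℕ) ∧ (i : ℕ) < m ∧
        x = eVar K n i - eVar K n ⟨0, by omega⟩} : Set (ExtE K n)) := by
  subst hJ
  set J := tsIdeal K n {x : ExtE K n | ∃ F : Finset (Fin n),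
      (∀ i ∈ F, (i : ℕ) < m) ∧ F.card = d + 1 ∧ x = osDelta K n F} with hJ
  have low : ∀ k < d, ∀ x ∈ eGrade K n k, x ∈ J → x = 0 := by
    intro k hk x hx hxJ
    rw [← proj_self k x hx]
    exact (J_proj m d x hxJ).1 k hk
  have hmul : ∀ p, ∀ u ∈ eGrade K n 1, ∀ v ∈ eGrade K n p, u * v ∈ eGrade K n (p + 1) := by
    intro p u hu v hv
    rw [add_comm]
    exact SetLike.mul_mem_graded hu hv
  refine ⟨fun p hp1 hp2 => ?_, ?_⟩
  · ext u
    constructor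
    · rintro ⟨hu, h | ⟨v, hv, -, -, h1, h2⟩⟩
      · exact h
      · exact absurd (low (p + 1) (by omega) _ (hmul p u hu v hv) h1) h2
    · rintro rfl
      exact ⟨Submodule.zero_mem _, Or.inl rfl⟩
  · rw [← map_Wsp]
    set z : Fin n := ⟨0, by omega⟩ with hz
    ext u
    constructor
    · rintro ⟨hu, rfl | ⟨v, hv, -, -, h1, h2⟩⟩
      · exact Submodule.zero_mem _
      · have huv := hmul _ u hu v hv
        rw [eGrade, pow_one] at hu
        obtain ⟨a, rfl⟩ := hu
        by_contra hcon
        have haW : a ∉ Wsp K n m z := fun h => hcon (Submodule.mem_map_of_mem h)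
        obtain ⟨φ, hφa, hφ⟩ := Submodule.exists_le_ker_of_notMem haW
        have hd1 : d - 1 + 1 = d := by omega
        rw [hd1] at huv
        have h3 := (J_proj m d _ h1).2 φ (φ (Pi.single z 1)) (by
          intro i hi
          by_cases h0 : (i : ℕ) = 0
          · have : i = z := Fin.ext h0
            rw [this]
          · have : (Pi.single i 1 - Pi.single z 1 : Fin n → K) ∈ LinearMap.ker φ :=
              hφ (Submodule.subset_span ⟨i, by omega, hi, rfl⟩)
            rw [LinearMap.mem_ker, map_sub, sub_eq_zero] at this
            exact this)
        rw [proj_self d _ huv] at h3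
        have h4 := congrArg (ct φ) (sq_mul a v)
        rw [ct_mul, h3, mul_zero, sub_zero, map_zero] at h4
        exact h2 ((smul_eq_zero.1 h4).resolve_left hφa)
    · rintro ⟨a, ha, rfl⟩
      have hu1 : ExteriorAlgebra.ι K a ∈ eGrade K n 1 := by
        rw [eGrade, pow_one]; exact ⟨a, rfl⟩
      refine ⟨hu1, ?_⟩
      by_cases ha0 : a = 0
      · left; rw [ha0, map_zero]
      right
      obtain ⟨v, U, hv, -, -, -, h2, h3⟩ := exists_v (Wsp K n m z) d
        (finrank_Wsp m d hdm hmn z rfl) a ha0 (d - 1) (by omega)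
      have hvg : v ∈ eGrade K n (d - 1) :=
        pow_le_pow_left' (LinearMap.map_le_range) _ hv
      refine ⟨v, hvg, ?_, ?_, ?_, h3⟩
      · intro hvJ
        exact h3 (by rw [low (d - 1) (by omega) v hvg hvJ, mul_zero])
      · rintro ⟨w, -, rfl⟩
        exact h3 (sq_mul a w)
      · have hda : (dsum : Module.Dual K (Fin n → K)) a = 0 := dsum_Wsp m z ha
        have e : ExteriorAlgebra.ι K a * v =
            ct dsum (eVar K n z * (ExteriorAlgebra.ι K a * v)) := by
          rw [eVar, ct_mul, ct_mul, h2 _ (dsum_Wsp m z), hda, dsum_single]; simp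
        rw [e]
        have hW : (Wsp K n m z).map (ExteriorAlgebra.ι K) ≤
            Submodule.span K {x : ExtE K n | ∃ i : Fin n, (i : ℕ) < m ∧ x = eVar K n i} := by
          rw [map_Wsp, Submodule.span_le]
          rintro _ ⟨i, -, hi, rfl⟩
          exact Submodule.sub_mem _ (Submodule.subset_span ⟨i, hi, rfl⟩)
            (Submodule.subset_span ⟨z, by simp [hz]; omega, rfl⟩)
        have hmem : eVar K n z * (ExteriorAlgebra.ι K a * v) ∈
            (Submodule.span K {x : ExtE K n | ∃ i : Fin n, (i : ℕ) < m ∧ x = eVar K n i})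
              ^ (d + 1) := by
          have hd2 : d + 1 = (d - 1) + 1 + 1 := by omega
          rw [hd2, pow_succ', pow_succ']
          exact Submodule.mul_mem_mul (Submodule.subset_span ⟨z, by simp [hz]; omega, rfl⟩)
            (Submodule.mul_mem_mul (hW (Submodule.mem_map_of_mem ha))
              (pow_le_pow_left' hW _ hv))
        have hmem2 := pow_le_span m (d + 1) hmem
        generalize eVar K n z * (ExteriorAlgebra.ι K a * v) = y at hmem2
        refine (Submodule.span_le (p := J.comap (ct dsum))).2 ?_ hmem2
        rintro _ ⟨F, hF, hc, rfl⟩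
        change ct dsum (eMonF K n F) ∈ J
        rw [← osDelta_eq]
        exact Submodule.subset_span ⟨1, osDelta K n F, 1, ⟨F, hF, hc, rfl⟩, by simp⟩
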